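/- arXiv:2008.02913 — 2 statements merged into one kernel-verified Lean document; each statement's English description precedes it below -/
import Mathlib

section
/- Let 𝔤 be a Lie algebra over ℝ, l ∈ ℕ, and c : Fin l → Fin l → ℝ an invertible l×l real matrix. Suppose h, h′, e, e′, f, f′ : Fin l → 𝔤 satisfy, for all i, j: [h i, h j] = 0, [e i, f j] = δ_{ij} • (h i), [h i, e j] = (c j i) • (e j), [h i, f j] = −(c j i) • (f j), [h i, h′ j] = 0, [h′ i, h′ j] = 0, [h i, e′ j] = (c j i) • (e′ j), [h i, f′ j] = −(c j i) • (f′ j), [h′ i, e j] = (c j i) • (e′ j), [h′ i, f j] = −(c j i) • (f′ j), [e i, f′ j] = δ_{ij} • (h′ i), [e′ i, f j] = δ_{ij} • (h′ i), [e′ i, f′ j] = −δ_{ij} • (h i), [h′ i, e′ j] = −(c j i) • (e j), [h′ i, f′ j] = (c j i) • (f j). Assume 𝔤 is generated as a real Lie algebra by the set {h i, h′ i, e i, e′ i, f i, f′ i : i ∈ Fin l}. Let K, E, F be the Lie subalgebras of 𝔤 generated respectively by {h i, h′ i}, {e i, e′ i}, {f i, f′ i}. Then 𝔤 = K + E + F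 and the sum is direct: every x ∈ 𝔤 has a unique expression x = x_K + x_E + x_F with x_K ∈ K, x_E ∈ E, x_F ∈ F. -/
noncomputable section

open LieSubalgebra Module.End in
/-- The sum of the eigenspaces of `ad x` for eigenvalues in an additively closed set is closed
under the bracket. -/
theorem lie_mem_biSup_eigenspace_ad {R L : Type*} [CommRing R] [LieRing L] [LieAlgebra R L]
    (x : L) {I : Set R} (hI : ∀ μ ∈ I, ∀ ν ∈ I, μ + ν ∈ I) {y z : L}
    (hy : y ∈ ⨆ μ ∈ I, eigenspace (LieAlgebra.ad R L x) μ)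
    (hz : z ∈ ⨆ μ ∈ I, eigenspace (LieAlgebra.ad R L x) μ) :
    ⁅y, z⁆ ∈ ⨆ μ ∈ I, eigenspace (LieAlgebra.ad R L x) μ := by
  set G := ⨆ μ ∈ I, eigenspace (LieAlgebra.ad R L x) μ with hG
  have key : ∀ μ ∈ I, ∀ a ∈ eigenspace (LieAlgebra.ad R L x) μ, ∀ ν ∈ I,
      ∀ b ∈ eigenspace (LieAlgebra.ad R L x) ν, ⁅a, b⁆ ∈ G := by
    intro μ hμ a ha ν hν b hb
    refine Submodule.mem_iSup_of_mem (μ + ν) (Submodule.mem_iSup_of_mem (hI μ hμ ν hν) ?_)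
    rw [mem_eigenspace_iff, LieAlgebra.ad_apply] at *
    rw [leibniz_lie, ha, hb, smul_lie, lie_smul, add_smul]
  have left : ∀ μ ∈ I, ∀ a ∈ eigenspace (LieAlgebra.ad R L x) μ, ⁅a, z⁆ ∈ G := by
    intro μ hμ a ha
    have : G ≤ G.comap (LieAlgebra.ad R L a) :=
      iSup₂_le fun ν hν b hb ↦ key μ hμ a ha ν hν b hb
    exact this hz
  have : G ≤ G.comap (LieAlgebra.ad R L z) := by
    refine iSup₂_le fun μ hμ a ha ↦ ?_
    rw [Submodule.mem_comap, LieAlgebra.ad_apply, ← lie_skew]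
    exact neg_mem (left μ hμ a ha)
  rw [← lie_skew]
  exact neg_mem (this hy)

open LieSubalgebra Module.End in
theorem lieSpan_le_biSup_eigenspace_ad {R L : Type*} [CommRing R] [LieRing L] [LieAlgebra R L]
    (x : L) {I : Set R} (hI : ∀ μ ∈ I, ∀ ν ∈ I, μ + ν ∈ I) {S : Set L}
    (hS : ∀ s ∈ S, ∃ μ ∈ I, ⁅x, s⁆ = μ • s) :
    (lieSpan R L S).toSubmodule ≤ ⨆ μ ∈ I, eigenspace (LieAlgebra.ad R L x) μ := by
  intro y hy
  rw [mem_toSubmodule] at hy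
  induction hy using lieSpan_induction with
  | mem s hs =>
    obtain ⟨μ, hμ, h⟩ := hS s hs
    exact Submodule.mem_iSup_of_mem μ (Submodule.mem_iSup_of_mem hμ (mem_eigenspace_iff.2 h))
  | zero => exact zero_mem _
  | add _ _ _ _ hu hv => exact add_mem hu hv
  | smul t _ _ hu => exact Submodule.smul_mem _ t hu
  | lie _ _ _ _ hu hv => exact lie_mem_biSup_eigenspace_ad x hI hu hv

open LieSubalgebra in
/-- A submodule that contains a set and is stable under bracketing with its elements contains the
Lie subalgebra generated by the set. -/
theorem lieSpan_le_of_lie_mem {R L : Type*} [CommRing R] [LieRing L] [LieAlgebra R L]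
    {S : Set L} {M : Submodule R L} (hS : S ⊆ M) (hM : ∀ s ∈ S, ∀ y ∈ M, ⁅s, y⁆ ∈ M) :
    (lieSpan R L S).toSubmodule ≤ M := by
  intro x hx
  rw [mem_toSubmodule] at hx
  suffices x ∈ M ∧ ∀ y ∈ M, ⁅x, y⁆ ∈ M from this.1
  induction hx using lieSpan_induction with
  | mem s hs => exact ⟨hS hs, hM s hs⟩
  | zero => exact ⟨zero_mem _, fun y _ ↦ by simp⟩
  | add _ _ _ _ hu hv =>
    exact ⟨add_mem hu.1 hv.1, fun y hy ↦ by
      rw [add_lie]; exact add_mem (hu.2 y hy) (hv.2 y hy)⟩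
  | smul t _ _ hu =>
    exact ⟨M.smul_mem t hu.1, fun y hy ↦ by rw [smul_lie]; exact M.smul_mem t (hu.2 y hy)⟩
  | lie _ _ _ _ hu hv =>
    exact ⟨hu.2 _ hv.1, fun y hy ↦ by
      rw [lie_lie]; exact sub_mem (hu.2 _ (hv.2 y hy)) (hv.2 _ (hu.2 y hy))⟩

open LieSubalgebra in
theorem mem_normalizer_lieSpan {R L : Type*} [CommRing R] [LieRing L] [LieAlgebra R L]
    {S : Set L} {x : L} (hx : ∀ s ∈ S, ⁅x, s⁆ ∈ lieSpan R L S) :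
    x ∈ (lieSpan R L S).normalizer := by
  rw [mem_normalizer_iff]
  intro y hy
  induction hy using lieSpan_induction with
  | mem s hs => exact hx s hs
  | zero => simp
  | add _ _ _ _ hu hv => rw [lie_add]; exact add_mem hu hv
  | smul t _ _ hu => rw [lie_smul]; exact (lieSpan R L S).smul_mem t hu
  | lie _ _ hu' hv' hu hv =>
    rw [leibniz_lie]; exact add_mem (lie_mem _ hu hv') (lie_mem _ hu' hv)

open LieSubalgebra in
theorem lie_mem_sup_lieSpan {R L : Type*} [CommRing R] [LieRing L] [LieAlgebra R L]
    {K : LieSubalgebra R L} {S : Set L} (hK : K ≤ (lieSpan R L S).normalizer) {x : L}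
    (hx : ∀ s ∈ S, ⁅x, s⁆ ∈ K) {y : L} (hy : y ∈ lieSpan R L S) :
    ⁅x, y⁆ ∈ K.toSubmodule ⊔ (lieSpan R L S).toSubmodule := by
  set F := lieSpan R L S with hF
  have key : F.toSubmodule ≤
      F.toSubmodule ⊓ (K.toSubmodule ⊔ F.toSubmodule).comap (LieAlgebra.ad R L x) := by
    refine lieSpan_le_of_lie_mem (fun s hs ↦ ⟨subset_lieSpan hs, ?_⟩) ?_
    · exact Submodule.mem_sup_left (hx s hs)
    · rintro s hs z ⟨hz, hxz⟩
      have hsF : s ∈ F := subset_lieSpan hs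
      refine ⟨F.lie_mem hsF hz, ?_⟩
      change ⁅x, z⁆ ∈ K.toSubmodule ⊔ F.toSubmodule at hxz
      change ⁅x, ⁅s, z⁆⁆ ∈ K.toSubmodule ⊔ F.toSubmodule
      obtain ⟨k, hk, w, hw, hkw⟩ := Submodule.mem_sup.1 hxz
      rw [leibniz_lie, ← hkw, lie_add]
      refine Submodule.mem_sup_right (add_mem ?_ (add_mem ?_ ?_))
      · exact (mem_normalizer_iff _ _).1 (hK (hx s hs)) z hz
      · exact (mem_normalizer_iff' _ _).1 (hK hk) s hsF
      · exact F.lie_mem hsF hw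
  exact (key hy).2

open LieSubalgebra in
theorem lieSpan_union_le_sup {R L : Type*} [CommRing R] [LieRing L] [LieAlgebra R L]
    {A B C : Set L}
    (hAB : ∀ a ∈ A, ∀ b ∈ B, ⁅a, b⁆ ∈ lieSpan R L B)
    (hAC : ∀ a ∈ A, ∀ c ∈ C, ⁅a, c⁆ ∈ lieSpan R L C)
    (hBC : ∀ b ∈ B, ∀ c ∈ C, ⁅b, c⁆ ∈ lieSpan R L A) :
    (lieSpan R L (A ∪ B ∪ C)).toSubmodule ≤
      (lieSpan R L A).toSubmodule ⊔ (lieSpan R L B).toSubmodule ⊔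
        (lieSpan R L C).toSubmodule := by
  have nB : lieSpan R L A ≤ (lieSpan R L B).normalizer :=
    lieSpan_le.2 fun a ha ↦ mem_normalizer_lieSpan (hAB a ha)
  have nC : lieSpan R L A ≤ (lieSpan R L C).normalizer :=
    lieSpan_le.2 fun a ha ↦ mem_normalizer_lieSpan (hAC a ha)
  have hCB : ∀ c ∈ C, ∀ b ∈ B, ⁅c, b⁆ ∈ lieSpan R L A := fun c hc b hb ↦ by
    rw [← lie_skew]; exact neg_mem (hBC b hb c hc)
  set M := (lieSpan R L A).toSubmodule ⊔ (lieSpan R L B).toSubmodule ⊔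
    (lieSpan R L C).toSubmodule with hM
  have iA : (lieSpan R L A).toSubmodule ≤ M := le_sup_left.trans le_sup_left
  have iB : (lieSpan R L B).toSubmodule ≤ M := le_sup_right.trans le_sup_left
  have iC : (lieSpan R L C).toSubmodule ≤ M := le_sup_right
  have sA {a} (ha : a ∈ A) : a ∈ lieSpan R L A := subset_lieSpan ha
  have sB {b} (hb : b ∈ B) : b ∈ lieSpan R L B := subset_lieSpan hb
  have sC {c} (hc : c ∈ C) : c ∈ lieSpan R L C := subset_lieSpan hc
  refine lieSpan_le_of_lie_mem ?_ fun s hs ↦ ?_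
  · rintro s ((hs | hs) | hs)
    exacts [iA (sA hs), iB (sB hs), iC (sC hs)]
  · suffices M ≤ M.comap (LieAlgebra.ad R L s) from this
    refine sup_le (sup_le ?_ ?_) ?_ <;> intro y hy <;> change ⁅s, y⁆ ∈ M <;>
      rcases hs with (hs | hs) | hs
    · exact iA (lie_mem _ (sA hs) hy)
    · exact iB ((mem_normalizer_iff' _ _).1 (nB hy) s (sB hs))
    · exact iC ((mem_normalizer_iff' _ _).1 (nC hy) s (sC hs))
    · exact iB ((mem_normalizer_iff _ _).1 (nB (sA hs)) y hy)
    · exact iB (lie_mem _ (sB hs) hy)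
    · exact sup_le iA iB (lie_mem_sup_lieSpan nB (hCB s hs) hy)
    · exact iC ((mem_normalizer_iff _ _).1 (nC (sA hs)) y hy)
    · exact sup_le iA iC (lie_mem_sup_lieSpan nC (hBC s hs) hy)
    · exact iC (lie_mem _ (sC hs) hy)

theorem triangular_decomposition_of_quaternification
    {𝔤 : Type*} [LieRing 𝔤] [LieAlgebra ℝ 𝔤]
    (l : ℕ) (c : Fin l → Fin l → ℝ) (hc : IsUnit (Matrix.of c))
    (h h' e e' f f' : Fin l → 𝔤)
    (rel_hh : ∀ i j, ⁅h i, h j⁆ = 0)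
    (rel_ef : ∀ i j, ⁅e i, f j⁆ = (if i = j then (1 : ℝ) else 0) • h i)
    (rel_he : ∀ i j, ⁅h i, e j⁆ = (c j i) • e j)
    (rel_hf : ∀ i j, ⁅h i, f j⁆ = -(c j i) • f j)
    (rel_hh' : ∀ i j, ⁅h i, h' j⁆ = 0)
    (rel_h'h' : ∀ i j, ⁅h' i, h' j⁆ = 0)
    (rel_he' : ∀ i j, ⁅h i, e' j⁆ = (c j i) • e' j)
    (rel_hf' : ∀ i j, ⁅h i, f' j⁆ = -(c j i) • f' j)
    (rel_h'e : ∀ i j, ⁅h' i, e j⁆ = (c j i) • e' j)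
    (rel_h'f : ∀ i j, ⁅h' i, f j⁆ = -(c j i) • f' j)
    (rel_ef' : ∀ i j, ⁅e i, f' j⁆ = (if i = j then (1 : ℝ) else 0) • h' i)
    (rel_e'f : ∀ i j, ⁅e' i, f j⁆ = (if i = j then (1 : ℝ) else 0) • h' i)
    (rel_e'f' : ∀ i j, ⁅e' i, f' j⁆ = -(if i = j then (1 : ℝ) else 0) • h i)
    (rel_h'e' : ∀ i j, ⁅h' i, e' j⁆ = -(c j i) • e j)
    (rel_h'f' : ∀ i j, ⁅h' i, f' j⁆ = (c j i) • f j)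
    (hgen : LieSubalgebra.lieSpan ℝ 𝔤
      {x | ∃ i, x = h i ∨ x = h' i ∨ x = e i ∨ x = e' i ∨ x = f i ∨ x = f' i} = ⊤) :
    ∀ x : 𝔤, ∃! t : 𝔤 × 𝔤 × 𝔤,
      t.1 ∈ LieSubalgebra.lieSpan ℝ 𝔤 {x | ∃ i, x = h i ∨ x = h' i} ∧
      t.2.1 ∈ LieSubalgebra.lieSpan ℝ 𝔤 {x | ∃ i, x = e i ∨ x = e' i} ∧
      t.2.2 ∈ LieSubalgebra.lieSpan ℝ 𝔤 {x | ∃ i, x = f i ∨ x = f' i} ∧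
      x = t.1 + t.2.1 + t.2.2 := by
  set A : Set 𝔤 := {x | ∃ i, x = h i ∨ x = h' i} with hA
  set B : Set 𝔤 := {x | ∃ i, x = e i ∨ x = e' i} with hB
  set C : Set 𝔤 := {x | ∃ i, x = f i ∨ x = f' i} with hC
  have mh (i) : h i ∈ LieSubalgebra.lieSpan ℝ 𝔤 A :=
    LieSubalgebra.subset_lieSpan ⟨i, Or.inl rfl⟩
  have mh' (i) : h' i ∈ LieSubalgebra.lieSpan ℝ 𝔤 A :=
    LieSubalgebra.subset_lieSpan ⟨i, Or.inr rfl⟩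
  have me (i) : e i ∈ LieSubalgebra.lieSpan ℝ 𝔤 B :=
    LieSubalgebra.subset_lieSpan ⟨i, Or.inl rfl⟩
  have me' (i) : e' i ∈ LieSubalgebra.lieSpan ℝ 𝔤 B :=
    LieSubalgebra.subset_lieSpan ⟨i, Or.inr rfl⟩
  have mf (i) : f i ∈ LieSubalgebra.lieSpan ℝ 𝔤 C :=
    LieSubalgebra.subset_lieSpan ⟨i, Or.inl rfl⟩
  have mf' (i) : f' i ∈ LieSubalgebra.lieSpan ℝ 𝔤 C :=
    LieSubalgebra.subset_lieSpan ⟨i, Or.inr rfl⟩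
  have hAB : ∀ a ∈ A, ∀ b ∈ B, ⁅a, b⁆ ∈ LieSubalgebra.lieSpan ℝ 𝔤 B := by
    rintro _ ⟨i, rfl | rfl⟩ _ ⟨j, rfl | rfl⟩
    · rw [rel_he]; exact SMulMemClass.smul_mem _ (me j)
    · rw [rel_he']; exact SMulMemClass.smul_mem _ (me' j)
    · rw [rel_h'e]; exact SMulMemClass.smul_mem _ (me' j)
    · rw [rel_h'e']; exact SMulMemClass.smul_mem _ (me j)
  have hAC : ∀ a ∈ A, ∀ b ∈ C, ⁅a, b⁆ ∈ LieSubalgebra.lieSpan ℝ 𝔤 C := by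
    rintro _ ⟨i, rfl | rfl⟩ _ ⟨j, rfl | rfl⟩
    · rw [rel_hf]; exact SMulMemClass.smul_mem _ (mf j)
    · rw [rel_hf']; exact SMulMemClass.smul_mem _ (mf' j)
    · rw [rel_h'f]; exact SMulMemClass.smul_mem _ (mf' j)
    · rw [rel_h'f']; exact SMulMemClass.smul_mem _ (mf j)
  have hBC : ∀ a ∈ B, ∀ b ∈ C, ⁅a, b⁆ ∈ LieSubalgebra.lieSpan ℝ 𝔤 A := by
    rintro _ ⟨i, rfl | rfl⟩ _ ⟨j, rfl | rfl⟩
    · rw [rel_ef]; exact SMulMemClass.smul_mem _ (mh i)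
    · rw [rel_ef']; exact SMulMemClass.smul_mem _ (mh' i)
    · rw [rel_e'f]; exact SMulMemClass.smul_mem _ (mh' i)
    · rw [rel_e'f']; exact SMulMemClass.smul_mem _ (mh i)
  have hunion : {x | ∃ i, x = h i ∨ x = h' i ∨ x = e i ∨ x = e' i ∨ x = f i ∨ x = f' i} ⊆
      A ∪ B ∪ C := by
    rintro x ⟨i, hx⟩
    simp only [hA, hB, hC, Set.mem_union, Set.mem_ofPred_eq]
    grind
  obtain ⟨a, ha⟩ := (Matrix.mulVec_surjective_iff_isUnit.2 hc) (fun _ ↦ (1 : ℝ))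
  replace ha (j) : ∑ i, a i * c j i = 1 := by
    have := congrFun ha j
    simpa [Matrix.mulVec, dotProduct, mul_comm] using this
  set H : 𝔤 := ∑ i, a i • h i with hH
  -- `ad H` acts on the three sets of generators with eigenvalues `0`, `1` and `-1`.
  have adH (s : 𝔤) (d : Fin l → ℝ) (hd : ∀ i, ⁅h i, s⁆ = d i • s) :
      ⁅H, s⁆ = (∑ i, a i * d i) • s := by
    simp [hH, sum_lie, hd, Finset.sum_smul, smul_smul]
  have wA : ∀ s ∈ A, ∃ μ ∈ ({0} : Set ℝ), ⁅H, s⁆ = μ • s := by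
    rintro _ ⟨j, rfl | rfl⟩
    · exact ⟨0, rfl, by rw [adH _ 0 (by simp [rel_hh])]; simp⟩
    · exact ⟨0, rfl, by rw [adH _ 0 (by simp [rel_hh'])]; simp⟩
  have wB : ∀ s ∈ B, ∃ μ ∈ Set.Ioi (0 : ℝ), ⁅H, s⁆ = μ • s := by
    rintro _ ⟨j, rfl | rfl⟩
    · exact ⟨1, Set.mem_Ioi.2 one_pos, by rw [adH _ (c j) (rel_he · j), ha]⟩
    · exact ⟨1, Set.mem_Ioi.2 one_pos, by rw [adH _ (c j) (rel_he' · j), ha]⟩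
  have wC : ∀ s ∈ C, ∃ μ ∈ Set.Iio (0 : ℝ), ⁅H, s⁆ = μ • s := by
    rintro _ ⟨j, rfl | rfl⟩
    · exact ⟨-1, by simp, by rw [adH _ (fun i ↦ -c j i) (rel_hf · j)]; simp [ha]⟩
    · exact ⟨-1, by simp, by rw [adH _ (fun i ↦ -c j i) (rel_hf' · j)]; simp [ha]⟩
  have gA := lieSpan_le_biSup_eigenspace_ad H (by simp) wA
  have gB := lieSpan_le_biSup_eigenspace_ad H (fun _ hμ _ hν ↦ Set.mem_Ioi.2 (add_pos hμ hν)) wB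
  have gC := lieSpan_le_biSup_eigenspace_ad H (fun _ hμ _ hν ↦ Set.mem_Iio.2 (add_neg hμ hν)) wC
  have ind := Module.End.eigenspaces_iSupIndep (LieAlgebra.ad ℝ 𝔤 H)
  have dBC : Disjoint (LieSubalgebra.lieSpan ℝ 𝔤 B).toSubmodule
      (LieSubalgebra.lieSpan ℝ 𝔤 C).toSubmodule :=
    (ind.disjoint_biSup_biSup (s := Set.Ioi 0) (t := Set.Iio 0)
      (Set.disjoint_left.2 fun _ h₁ h₂ ↦ lt_asymm h₁ h₂)).mono gB gC
  have dA : Disjoint (LieSubalgebra.lieSpan ℝ 𝔤 A).toSubmodule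
      ((LieSubalgebra.lieSpan ℝ 𝔤 B).toSubmodule ⊔ (LieSubalgebra.lieSpan ℝ 𝔤 C).toSubmodule) :=
    (ind.disjoint_biSup_biSup (s := {0}) (t := Set.Ioi 0 ∪ Set.Iio 0)
      (by simp)).mono gA (by rw [iSup_union]; exact sup_le_sup gB gC)
  intro x
  have hx : x ∈ LieSubalgebra.lieSpan ℝ 𝔤 (A ∪ B ∪ C) :=
    LieSubalgebra.lieSpan_mono hunion (hgen ▸ LieSubalgebra.mem_top x)
  obtain ⟨y, hy, z, hz, hyz⟩ := Submodule.mem_sup.1 (lieSpan_union_le_sup hAB hAC hBC hx)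
  obtain ⟨u, hu, v, hv, rfl⟩ := Submodule.mem_sup.1 hy
  refine ⟨(u, v, z), ⟨hu, hv, hz, hyz.symm⟩, ?_⟩
  rintro ⟨u', v', z'⟩ ⟨hu', hv', hz', hx'⟩
  dsimp only at hu' hv' hz' hx'
  have hsum : u' - u = (v - v') + (z - z') := by
    have : u' - u = (u' + v' + z') - (u + v + z) + ((v - v') + (z - z')) := by abel
    rw [this, ← hx', hyz, sub_self, zero_add]
  have h₁ : u' - u = 0 := Submodule.disjoint_def.1 dA _ (sub_mem hu' hu)
    (hsum ▸ Submodule.add_mem_sup (sub_mem hv hv') (sub_mem hz hz'))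
  rw [h₁] at hsum
  have h₂ : v - v' = 0 := Submodule.disjoint_def.1 dBC _ (sub_mem hv hv') (by
    rw [eq_neg_of_add_eq_zero_left hsum.symm]
    exact neg_mem (sub_mem hz hz'))
  rw [h₂, zero_add] at hsum
  rw [sub_eq_zero.1 h₁, sub_eq_zero.1 h₂, sub_eq_zero.1 hsum.symm]
end
end

section
/- Let l ∈ ℕ, c : Fin l → Fin l → ℝ, and let F = FreeAlgebra ℝ (Fin l) be the free associative unital ℝ-algebra on generators ι(1), …, ι(l). Suppose for each j: D_j : F → F is an ℝ-derivation (ℝ-linear with D_j(uv) = D_j(u)v + uD_j(v)) satisfying D_j(ι i) = −(c i j) • ι i for all i; and E_j : F → F is an ℝ-linear map satisfying E_j(1) = 0 and E_j(ι i · u) = ι i · E_j(u) + δ_{ij} • D_j(u) for all i and all u ∈ F. On V = F × F define the ℝ-linear endomorphisms: ρh_j(u,v) = (D_j u, D_j v), ρJh_j(u,v) = (−D_j v, D_j u), ρf_j(u,v) = (ι j·u, ι j·v), ρJf_j(u,v) = (−ι j·v, ι j·u), ρe_j(u,v) = (E_j u, E_j v), ρJe_j(u,v) = (−E_j v, E_j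 u). Then with [S,T] = S∘T − T∘S these endomorphisms satisfy, for all i, j: [ρh_i, ρh_j] = 0, [ρe_i, ρf_j] = δ_{ij} ρh_i, [ρh_i, ρe_j] = (c j i) ρe_j, [ρh_i, ρf_j] = −(c j i) ρf_j, [ρh_i, ρJh_j] = 0, [ρJh_i, ρJh_j] = 0, [ρh_i, ρJe_j] = (c j i) ρJe_j, [ρh_i, ρJf_j] = −(c j i) ρJf_j, [ρJh_i, ρe_j] = (c j i) ρJe_j, [ρJh_i, ρf_j] = −(c j i) ρJf_j, [ρe_i, ρJf_j] = δ_{ij} ρJh_i, [ρJe_i, ρf_j] = δ_{ij} ρJh_i, [ρJe_i, ρJf_j] = −δ_{ij} ρh_i, [ρJh_i, ρJe_j] = −(c j i) ρe_j, [ρJh_i, ρJf_j] = (c j i) ρf_j. -/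
noncomputable section

/-- The free associative unital ℝ-algebra on `l` generators. -/
abbrev FA (l : ℕ) := FreeAlgebra ℝ (Fin l)

/-- ρh_j (u,v) = (D_j u, D_j v). -/
def ρh {l : ℕ} (D : Fin l → FA l →ₗ[ℝ] FA l) (j : Fin l) :
    Module.End ℝ (FA l × FA l) := (D j).prodMap (D j)

/-- ρJh_j (u,v) = (−D_j v, D_j u). -/
def ρJh {l : ℕ} (D : Fin l → FA l →ₗ[ℝ] FA l) (j : Fin l) :
    Module.End ℝ (FA l × FA l) :=
  LinearMap.prod (-((D j).comp (LinearMap.snd ℝ (FA l) (FA l))))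
    ((D j).comp (LinearMap.fst ℝ (FA l) (FA l)))

/-- Left multiplication by the generator ι j. -/
def mulι {l : ℕ} (j : Fin l) : FA l →ₗ[ℝ] FA l :=
  LinearMap.mulLeft ℝ (FreeAlgebra.ι ℝ j)

/-- ρf_j (u,v) = (ι j · u, ι j · v). -/
def ρf {l : ℕ} (j : Fin l) : Module.End ℝ (FA l × FA l) :=
  (mulι j).prodMap (mulι j)

/-- ρJf_j (u,v) = (−ι j · v, ι j · u). -/
def ρJf {l : ℕ} (j : Fin l) : Module.End ℝ (FA l × FA l) :=
  LinearMap.prod (-((mulι j).comp (LinearMap.snd ℝ (FA l) (FA l))))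
    ((mulι j).comp (LinearMap.fst ℝ (FA l) (FA l)))

/-- ρe_j (u,v) = (E_j u, E_j v). -/
def ρe {l : ℕ} (E : Fin l → FA l →ₗ[ℝ] FA l) (j : Fin l) :
    Module.End ℝ (FA l × FA l) := (E j).prodMap (E j)

/-- ρJe_j (u,v) = (−E_j v, E_j u). -/
def ρJe {l : ℕ} (E : Fin l → FA l →ₗ[ℝ] FA l) (j : Fin l) :
    Module.End ℝ (FA l × FA l) :=
  LinearMap.prod (-((E j).comp (LinearMap.snd ℝ (FA l) (FA l))))
    ((E j).comp (LinearMap.fst ℝ (FA l) (FA l)))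

/-- Linear maps out of a free algebra agree if they agree at `1` and agreement propagates along left
multiplication by generators. -/
theorem FreeAlgebra.linearMap_ext_of_ι_mul {R X M : Type*} [CommSemiring R] [AddCommMonoid M]
    [Module R M] {f g : FreeAlgebra R X →ₗ[R] M} (one : f 1 = g 1)
    (ι_mul : ∀ x u, f u = g u → f (FreeAlgebra.ι R x * u) = g (FreeAlgebra.ι R x * u)) :
    f = g := by
  have key : ∀ a u, f u = g u → f (a * u) = g (a * u) := by
    intro a
    induction a using FreeAlgebra.induction with
    | grade0 r =>
      intro u hu
      rw [← Algebra.smul_def, map_smul, map_smul, hu]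
    | grade1 x => exact ι_mul x
    | mul a b ha hb =>
      intro u hu
      rw [mul_assoc]
      exact ha _ (hb _ hu)
    | add a b ha hb =>
      intro u hu
      rw [add_mul, map_add, map_add, ha _ hu, hb _ hu]
  ext a
  simpa using key a 1 one

theorem map_one_eq_zero_of_leibniz {R A : Type*} [CommSemiring R] [Ring A] [Algebra R A]
    (D : A →ₗ[R] A) (hD : ∀ u v, D (u * v) = D u * v + u * D v) : D 1 = 0 := by
  simpa using hD 1 1

theorem representation_of_quaternified_relations (l : ℕ) (c : Fin l → Fin l → ℝ)
    (D E : Fin l → FA l →ₗ[ℝ] FA l)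
    (hD_leib : ∀ (j : Fin l) (u v : FA l), D j (u * v) = D j u * v + u * D j v)
    (hD_gen : ∀ j i : Fin l, D j (FreeAlgebra.ι ℝ i) = -(c i j) • FreeAlgebra.ι ℝ i)
    (hE_one : ∀ j : Fin l, E j 1 = 0)
    (hE_rec : ∀ (j i : Fin l) (u : FA l), E j (FreeAlgebra.ι ℝ i * u)
      = FreeAlgebra.ι ℝ i * E j u + (if i = j then (1 : ℝ) else 0) • D j u) :
    ∀ i j : Fin l,
      ⁅ρh D i, ρh D j⁆ = 0 ∧
      ⁅ρe E i, ρf j⁆ = (if i = j then (1 : ℝ) else 0) • ρh D i ∧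
      ⁅ρh D i, ρe E j⁆ = (c j i) • ρe E j ∧
      ⁅ρh D i, ρf j⁆ = -(c j i) • ρf j ∧
      ⁅ρh D i, ρJh D j⁆ = 0 ∧
      ⁅ρJh D i, ρJh D j⁆ = 0 ∧
      ⁅ρh D i, ρJe E j⁆ = (c j i) • ρJe E j ∧
      ⁅ρh D i, ρJf j⁆ = -(c j i) • ρJf j ∧
      ⁅ρJh D i, ρe E j⁆ = (c j i) • ρJe E j ∧
      ⁅ρJh D i, ρf j⁆ = -(c j i) • ρJf j ∧
      ⁅ρe E i, ρJf j⁆ = (if i = j then (1 : ℝ) else 0) • ρJh D i ∧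
      ⁅ρJe E i, ρf j⁆ = (if i = j then (1 : ℝ) else 0) • ρJh D i ∧
      ⁅ρJe E i, ρJf j⁆ = -(if i = j then (1 : ℝ) else 0) • ρh D i ∧
      ⁅ρJh D i, ρJe E j⁆ = -(c j i) • ρe E j ∧
      ⁅ρJh D i, ρJf j⁆ = (c j i) • ρf j := by
  have hD_one (j : Fin l) : D j 1 = 0 := map_one_eq_zero_of_leibniz (D j) (hD_leib j)
  have hDι (j k : Fin l) (u : FA l) : D j (FreeAlgebra.ι ℝ k * u) =
      FreeAlgebra.ι ℝ k * D j u - c k j • (FreeAlgebra.ι ℝ k * u) := by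
    rw [hD_leib, hD_gen, smul_mul_assoc]
    module
  have hDD (i j : Fin l) (u : FA l) : D i (D j u) = D j (D i u) := by
    suffices h : D i ∘ₗ D j = D j ∘ₗ D i from LinearMap.congr_fun h u
    apply FreeAlgebra.linearMap_ext_of_ι_mul
    · simp [hD_one]
    · intro k u hu
      simp only [LinearMap.comp_apply] at hu ⊢
      simp only [hDι, map_sub, map_smul, hu]
      module
  have hDE (i j : Fin l) (u : FA l) : D i (E j u) = E j (D i u) + c j i • E j u := by
    suffices h : D i ∘ₗ E j = E j ∘ₗ D i + c j i • E j from LinearMap.congr_fun h u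
    apply FreeAlgebra.linearMap_ext_of_ι_mul
    · simp [hD_one, hE_one]
    · intro k u hu
      simp only [LinearMap.comp_apply, LinearMap.add_apply, LinearMap.smul_apply] at hu ⊢
      simp only [hDι, hE_rec, map_add, map_sub, map_smul, hu, hDD i j, mul_add, mul_smul_comm]
      split_ifs with hkj
      · subst hkj
        module
      · module
  intro i j
  have hδ : (if j = i then (1 : ℝ) else 0) = if i = j then 1 else 0 := by
    simp only [eq_comm]
  refine ⟨?_, ?_, ?_, ?_, ?_, ?_, ?_, ?_, ?_, ?_, ?_, ?_, ?_, ?_, ?_⟩ <;>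
  · refine LinearMap.ext fun ⟨u, v⟩ => Prod.ext ?_ ?_ <;>
    · simp only [Ring.lie_def, ρh, ρJh, ρf, ρJf, ρe, ρJe, mulι, LinearMap.sub_apply,
        Module.End.mul_apply, LinearMap.smul_apply, LinearMap.zero_apply, LinearMap.prodMap_apply,
        LinearMap.prod_apply, Function.prod, LinearMap.neg_apply, LinearMap.comp_apply,
        LinearMap.fst_apply, LinearMap.snd_apply, LinearMap.mulLeft_apply, Prod.fst_sub,
        Prod.snd_sub, Prod.smul_fst, Prod.smul_snd, Prod.fst_zero, Prod.snd_zero, map_neg,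
        hDι, hE_rec, hDE, hDD i j, hδ]
      module
end
end
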